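/- Let n ≥ 2. Then T_n = (∪_{M ∈ M_{n−1}(k)} O(T_0^M)) ∪ (∪_{M ∈ M_{n−1}(k)} O(T_1^M)). Moreover, for r,s ∈ {0,1} and M,L ∈ M_{n−1}(k), the structures T_r^M and T_s^L lie in the same GL(V)-orbit if and only if either (r = s = 1 and L = U⁻¹MU for some U ∈ GL_{n−1}(k)) or (r = s = 0 and L = αU⁻¹MU for some α ∈ k∖{0} and U ∈ GL_{n−1}(k)). -/

import Mathlib

open scoped BigOperators

noncomputable section

/-- The space of `n`-dimensional (nonassociative) algebra structures on `kⁿ`: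
bilinear maps `kⁿ × kⁿ → kⁿ`. -/
abbrev AlgStr (k : Type*) [Field k] (n : ℕ) : Type _ :=
  (Fin n → k) →ₗ[k] (Fin n → k) →ₗ[k] (Fin n → k)

variable {k : Type*} [Field k]

/-- The algebra structure with prescribed structure constants `c`:
`μ(x, y) m = ∑ i, ∑ j, x i * y j * c i j m`. -/
def ofConst {n : ℕ} (c : Fin n → Fin n → Fin n → k) : AlgStr k n :=
  ∑ i, ∑ j,
    ((LinearMap.mul k k).compl₁₂ (LinearMap.proj i) (LinearMap.proj j)).compr₂
      (LinearMap.toSpanSingleton k (Fin n → k) (c i j))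

/-- The structure constants of an algebra structure in the standard basis. -/
def structConst {n : ℕ} (μ : AlgStr k n) : Fin n × Fin n × Fin n → k :=
  fun t => μ (Pi.single t.1 1) (Pi.single t.2.1 1) t.2.2

/-- A subset of `AlgStr k n` is Zariski closed if it is the common zero locus of a
family of polynomials in the structure constants. -/
def IsZariskiClosed {n : ℕ} (S : Set (AlgStr k n)) : Prop :=
  ∃ P : Set (MvPolynomial (Fin n × Fin n × Fin n) k),
    ∀ μ : AlgStr k n, μ ∈ S ↔ ∀ p ∈ P, MvPolynomial.eval (structConst μ) p = 0

/-- The action of `GL(V)` on algebra structures: `(g • μ)(x,y) = g (μ (g⁻¹ x) (g⁻¹ y))`. -/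
def transport {n : ℕ} (g : (Fin n → k) ≃ₗ[k] (Fin n → k)) (μ : AlgStr k n) :
    AlgStr k n :=
  ((μ.comp g.symm.toLinearMap).compl₂ g.symm.toLinearMap).compr₂ g.toLinearMap

/-- The `GL(V)`-orbit of an algebra structure; two structures represent isomorphic
algebras iff they lie in the same orbit. -/
def orbit {n : ℕ} (μ : AlgStr k n) : Set (AlgStr k n) :=
  {χ | ∃ g : (Fin n → k) ≃ₗ[k] (Fin n → k), transport g μ = χ}

/-- The Zariski closure of a set of algebra structures. -/
def zclosure {n : ℕ} (S : Set (AlgStr k n)) : Set (AlgStr k n) :=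
  {χ | ∀ T : Set (AlgStr k n), IsZariskiClosed T → S ⊆ T → χ ∈ T}

/-- `μ` degenerates to `χ` if `χ` lies in the Zariski closure of the orbit of `μ`. -/
def degenerates {n : ℕ} (μ χ : AlgStr k n) : Prop :=
  χ ∈ zclosure (orbit μ)

/-- A proper degeneration: additionally `χ` is not isomorphic to `μ`. -/
def properlyDegenerates {n : ℕ} (μ χ : AlgStr k n) : Prop :=
  degenerates μ χ ∧ χ ∉ orbit μ

/-- There is a chain of `m` proper degenerations starting at `μ`. -/
def hasChain {n : ℕ} (μ : AlgStr k n) (m : ℕ) : Prop :=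
  ∃ c : ℕ → AlgStr k n, c m = μ ∧ ∀ i < m, properlyDegenerates (c (i + 1)) (c i)

/-- The level of `μ` is `m`: there is a chain of `m` proper degenerations starting
at `μ` but no chain of `m+1`. -/
def levelIs {n : ℕ} (μ : AlgStr k n) (m : ℕ) : Prop :=
  hasChain μ m ∧ ¬ hasChain μ (m + 1)

/-- The subalgebra generated by a set `s`. -/
def subalgGen {n : ℕ} (μ : AlgStr k n) (s : Set (Fin n → k)) :
    Submodule k (Fin n → k) :=
  sInf {W | s ⊆ W ∧ ∀ x ∈ W, ∀ y ∈ W, μ x y ∈ W}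

/-- The generation type of `μ` is `m`: `m` is the maximal dimension of a
one-generated subalgebra. -/
def genType {n : ℕ} (μ : AlgStr k n) (m : ℕ) : Prop :=
  IsGreatest {d : ℕ | ∃ a : Fin n → k, Module.finrank k ↥(subalgGen μ {a}) = d} m

/-- A standard `1`-generated algebra: it admits a grading `A = ⊕_{i ≥ 1} A_i` with
`dim A_1 = 1`, `A_i A_j ⊆ A_{i+j}`, generated by `A_1` as an algebra. -/
def StandardOneGenerated {m : ℕ} (μ : AlgStr k m) : Prop :=
  ∃ A : ℕ → Submodule k (Fin m → k),
    A 0 = ⊥ ∧ DirectSum.IsInternal A ∧ Module.finrank k ↥(A 1) = 1 ∧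
    (∀ i j : ℕ, ∀ x ∈ A i, ∀ y ∈ A j, μ x y ∈ A (i + j)) ∧
    subalgGen μ ((A 1 : Submodule k (Fin m → k)) : Set (Fin m → k)) = ⊤

/-- Extension by zero of coordinates, `kᵐ → kⁿ`. -/
def inclMap (k : Type*) [Field k] {m n : ℕ} (h : m ≤ n) :
    (Fin m → k) →ₗ[k] (Fin n → k) where
  toFun x i := if hi : (i : ℕ) < m then x ⟨i, hi⟩ else 0
  map_add' x y := by funext i; by_cases hi : (i : ℕ) < m <;> simp [hi]
  map_smul' a x := by funext i; by_cases hi : (i : ℕ) < m <;> simp [hi]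

/-- The `n`-dimensional algebra `B ⊕ k^{n-m}` obtained from an `m`-dimensional
algebra `B` by adjoining a complement with all products zero. -/
def extendZero {m n : ℕ} (h : m ≤ n) (B : AlgStr k m) : AlgStr k n :=
  ((B.comp (LinearMap.funLeft k k (Fin.castLE h))).compl₂
      (LinearMap.funLeft k k (Fin.castLE h))).compr₂ (inclMap k h)

/-- The `i`-th standard basis vector (as a plain function, `0` if `i ≥ n`). -/
def unitVec {k : Type*} [Field k] (n i : ℕ) : Fin n → k :=
  fun j => if (j : ℕ) = i then 1 else 0

/-- Projection onto the coordinate `0` part. -/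
def proj0 (k : Type*) [Field k] (n : ℕ) : (Fin n → k) →ₗ[k] (Fin n → k) :=
  LinearMap.pi fun i => if (i : ℕ) = 0 then LinearMap.proj i else 0

/-- Projection onto the coordinates `≥ 1` part. -/
def projPos (k : Type*) [Field k] (n : ℕ) : (Fin n → k) →ₗ[k] (Fin n → k) :=
  LinearMap.pi fun i => if (i : ℕ) = 0 then 0 else LinearMap.proj i

/-- The Inönü–Wigner contraction of `μ` with respect to the `1`-dimensional
subalgebra spanned by the first basis vector (the remaining coordinates form the
square-zero ideal part). -/
def IWcontract0 {n : ℕ} (μ : AlgStr k n) : AlgStr k n :=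
  ((μ.comp (projPos k n)).compl₂ (proj0 k n)).compr₂ (projPos k n) +
    ((μ.comp (proj0 k n)).compl₂ (projPos k n)).compr₂ (projPos k n) +
    (μ.comp (proj0 k n)).compl₂ (proj0 k n)

/-- The annihilator of an algebra structure. -/
def annihilator {n : ℕ} (μ : AlgStr k n) : Submodule k (Fin n → k) where
  carrier := {a | ∀ b, μ a b = 0 ∧ μ b a = 0}
  add_mem' := by
    intro a b ha hb
    intro c
    constructor
    · rw [map_add, LinearMap.add_apply, (ha c).1, (hb c).1, add_zero]
    · rw [map_add, (ha c).2, (hb c).2, add_zero]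
  zero_mem' := by
    intro b
    constructor
    · rw [map_zero, LinearMap.zero_apply]
    · rw [map_zero]
  smul_mem' := by
    intro t a ha b
    constructor
    · rw [map_smul, LinearMap.smul_apply, (ha b).1, smul_zero]
    · rw [map_smul, (ha b).2, smul_zero]

/-- `μ` has a square-zero (two-sided) ideal of codimension `1`. -/
def hasSqZeroIdealCodim1 {n : ℕ} (μ : AlgStr k n) : Prop :=
  ∃ I : Submodule k (Fin n → k), Module.finrank k ↥I = n - 1 ∧
    (∀ x ∈ I, ∀ y : Fin n → k, μ x y ∈ I ∧ μ y x ∈ I) ∧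
    ∀ x ∈ I, ∀ y ∈ I, μ x y = 0

/-- `a` (viewed as the sequence of parts `a 0 ≥ a 1 ≥ …`) is a partition of `N`. -/
def IsPartitionOf (a : ℕ → ℕ) (N : ℕ) : Prop :=
  (∀ i j : ℕ, i ≤ j → a j ≤ a i) ∧
    ∃ l : ℕ, (∀ i, l ≤ i → a i = 0) ∧ ∑ i ∈ Finset.range l, a i = N

/-- The dominance order on partitions: `a ⪰ b`. -/
def Dominates (a b : ℕ → ℕ) : Prop :=
  ∀ m : ℕ, ∑ i ∈ Finset.range m, b i ≤ ∑ i ∈ Finset.range m, a i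

/-- `a` is the Jordan type of the matrix `M` at the eigenvalue `lam`:
`a` is a partition of the generalized eigenspace dimension, and the parts of `a`
are the sizes of the Jordan blocks of `M` with eigenvalue `lam`, expressed via
the ranks of powers of `M - lam • 1`. -/
def IsJordanTypeAt {N : ℕ} (M : Matrix (Fin N) (Fin N) k) (lam : k) (a : ℕ → ℕ) :
    Prop :=
  IsPartitionOf a (N - ((M - lam • (1 : Matrix (Fin N) (Fin N) k)) ^ N).rank) ∧
    ∀ p : ℕ, ((M - lam • (1 : Matrix (Fin N) (Fin N) k)) ^ p).rank =
      N - ∑ i ∈ Finset.range N, min (a i) p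

/-- The full specter of `M` is `{(lam i, a i)}`: the `lam i` are pairwise distinct,
each `a i` is the (nonempty) Jordan type of `M` at `lam i`, and every eigenvalue
of `M` occurs among the `lam i`. -/
def IsFullSpecter {N : ℕ} (M : Matrix (Fin N) (Fin N) k) {l : ℕ}
    (lam : Fin l → k) (a : Fin l → ℕ → ℕ) : Prop :=
  Function.Injective lam ∧
    (∀ i, IsJordanTypeAt M (lam i) (a i) ∧ a i 0 ≠ 0) ∧
    ∀ c : k, (∃ v : Fin N → k, v ≠ 0 ∧ M.mulVec v = c • v) → ∃ i, lam i = c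

/-- There is a chain of `len` strict dominance steps of partitions of `N`
starting (on top) at `a`. -/
def partChain (a : ℕ → ℕ) (N len : ℕ) : Prop :=
  ∃ c : ℕ → ℕ → ℕ, (∀ i ≤ len, IsPartitionOf (c i) N) ∧ c len = a ∧
    ∀ i < len, Dominates (c (i + 1)) (c i) ∧ c (i + 1) ≠ c i

/-- The structure `T_α^M ∈ A_{m+1}`. -/
def Tstr {m : ℕ} (α : k) (M : Matrix (Fin m) (Fin m) k) : AlgStr k (m + 1) :=
  ofConst fun i j mm =>
    if hi : i = 0 then
      if hj : j = 0 then (if mm = 0 then α else 0)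
      else if hmm : mm = 0 then 0 else M (mm.pred hmm) (j.pred hj)
    else if hj : j = 0 then
      if hmm : mm = 0 then 0 else (if i = mm then α else 0) - M (mm.pred hmm) (i.pred hi)
    else 0

/-- The trivial singular extension `k^{n-2} ⋊_{(L₁,R₁,L₂,R₂)} χ` of the
`2`-dimensional algebra `χ` given by the coefficients `c11, c12, c21, d12, d21, d22`
(with `χ(e₁,e₁) = c11·e₁ + e₂`, `χ(e₁,e₂) = c12·e₁ + d12·e₂`,
`χ(e₂,e₁) = c21·e₁ + d21·e₂`, `χ(e₂,e₂) = d22·e₂`). -/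
def sdExt {m : ℕ} (c11 c12 c21 d12 d21 d22 : k)
    (L1 R1 L2 R2 : Matrix (Fin m) (Fin m) k) : AlgStr k (m + 2) :=
  ofConst fun i j mm =>
    if hi0 : (i : ℕ) = 0 then
      if hj0 : (j : ℕ) = 0 then
        if (mm : ℕ) = 0 then c11 else if (mm : ℕ) = 1 then 1 else 0
      else if hj1 : (j : ℕ) = 1 then
        if (mm : ℕ) = 0 then c12 else if (mm : ℕ) = 1 then d12 else 0
      else if hmm : (mm : ℕ) < 2 then 0
      else L1 ⟨(mm : ℕ) - 2, by have := mm.isLt; omega⟩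
             ⟨(j : ℕ) - 2, by have := j.isLt; omega⟩
    else if hi1 : (i : ℕ) = 1 then
      if hj0 : (j : ℕ) = 0 then
        if (mm : ℕ) = 0 then c21 else if (mm : ℕ) = 1 then d21 else 0
      else if hj1 : (j : ℕ) = 1 then
        if (mm : ℕ) = 1 then d22 else 0
      else if hmm : (mm : ℕ) < 2 then 0
      else L2 ⟨(mm : ℕ) - 2, by have := mm.isLt; omega⟩
             ⟨(j : ℕ) - 2, by have := j.isLt; omega⟩
    else
      if hj0 : (j : ℕ) = 0 then
        if hmm : (mm : ℕ) < 2 then 0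
        else R1 ⟨(mm : ℕ) - 2, by have := mm.isLt; omega⟩
               ⟨(i : ℕ) - 2, by have := i.isLt; omega⟩
      else if hj1 : (j : ℕ) = 1 then
        if hmm : (mm : ℕ) < 2 then 0
        else R2 ⟨(mm : ℕ) - 2, by have := mm.isLt; omega⟩
               ⟨(i : ℕ) - 2, by have := i.isLt; omega⟩
      else 0

/-! Concrete algebra structures, given by multiplication tables on the standard
basis `e₁, …, eₙ` (0-indexed as `0, …, n-1`); all unspecified products are zero. -/

/-- `A₃ ⊕ k^{n-2}`: `e₁e₁ = e₂`. -/
def A3str (n : ℕ) : AlgStr k n :=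
  ofConst fun i j m => if (i : ℕ) = 0 ∧ (j : ℕ) = 0 ∧ (m : ℕ) = 1 then 1 else 0

/-- `n₃ ⊕ k^{n-3}`: `e₁e₂ = e₃`, `e₂e₁ = -e₃`. -/
def n3str (n : ℕ) : AlgStr k n :=
  ofConst fun i j m =>
    if (i : ℕ) = 0 ∧ (j : ℕ) = 1 ∧ (m : ℕ) = 2 then 1
    else if (i : ℕ) = 1 ∧ (j : ℕ) = 0 ∧ (m : ℕ) = 2 then -1
    else 0

/-- `p⁻`: `e₁eᵢ = eᵢ`, `eᵢe₁ = -eᵢ` for `i ≥ 2`. -/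
def pminusStr (n : ℕ) : AlgStr k n :=
  ofConst fun i j m =>
    if (i : ℕ) = 0 ∧ 1 ≤ (j : ℕ) ∧ m = j then 1
    else if 1 ≤ (i : ℕ) ∧ (j : ℕ) = 0 ∧ m = i then -1
    else 0

/-- `ν^α`: `e₁e₁ = e₁`, `e₁eᵢ = α eᵢ`, `eᵢe₁ = (1-α) eᵢ` for `i ≥ 2`. -/
def nuStr (n : ℕ) (α : k) : AlgStr k n :=
  ofConst fun i j m =>
    if (i : ℕ) = 0 then
      if (j : ℕ) = 0 then (if (m : ℕ) = 0 then 1 else 0)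
      else (if m = j then α else 0)
    else if (j : ℕ) = 0 then (if m = i then 1 - α else 0)
    else 0

/-- `k^{n-2} ⋊ E₄`: `e₁e₁ = e₁`, `e₁e₂ = e₁ + e₂`, `e₂e₂ = e₂`,
`e₁eᵢ = eᵢ`, `eᵢe₂ = eᵢ` for `i ≥ 3`.  (For `n = 2` this is `E₄`.) -/
def kE4str (n : ℕ) : AlgStr k n :=
  ofConst fun i j m =>
    if (i : ℕ) = 0 ∧ (j : ℕ) = 0 then (if (m : ℕ) = 0 then 1 else 0)
    else if (i : ℕ) = 0 ∧ (j : ℕ) = 1 then (if (m : ℕ) = 0 ∨ (m : ℕ) = 1 then 1 else 0)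
    else if (i : ℕ) = 1 ∧ (j : ℕ) = 1 then (if (m : ℕ) = 1 then 1 else 0)
    else if (i : ℕ) = 0 ∧ 2 ≤ (j : ℕ) then (if m = j then 1 else 0)
    else if 2 ≤ (i : ℕ) ∧ (j : ℕ) = 1 then (if m = i then 1 else 0)
    else 0

/-- `T₀^{2,(α,β)}`: `e₁e₂ = αe₂ + e₃`, `e₂e₁ = -αe₂ - e₃`,
`e₁eᵢ = βeᵢ`, `eᵢe₁ = -βeᵢ` for `i ≥ 3`. -/
def T02str (n : ℕ) (α β : k) : AlgStr k n :=
  ofConst fun i j m =>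
    if (i : ℕ) = 0 ∧ (j : ℕ) = 1 then
      (if (m : ℕ) = 1 then α else if (m : ℕ) = 2 then 1 else 0)
    else if (i : ℕ) = 1 ∧ (j : ℕ) = 0 then
      (if (m : ℕ) = 1 then -α else if (m : ℕ) = 2 then -1 else 0)
    else if (i : ℕ) = 0 ∧ 2 ≤ (j : ℕ) then (if m = j then β else 0)
    else if 2 ≤ (i : ℕ) ∧ (j : ℕ) = 0 then (if m = i then -β else 0)
    else 0

/-- `T₁^{2,(α,β)}`: `e₁e₁ = e₁`, `e₁e₂ = αe₂ + e₃`, `e₂e₁ = (1-α)e₂ - e₃`,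
`e₁eᵢ = βeᵢ`, `eᵢe₁ = (1-β)eᵢ` for `i ≥ 3`. -/
def T12str (n : ℕ) (α β : k) : AlgStr k n :=
  ofConst fun i j m =>
    if (i : ℕ) = 0 ∧ (j : ℕ) = 0 then (if (m : ℕ) = 0 then 1 else 0)
    else if (i : ℕ) = 0 ∧ (j : ℕ) = 1 then
      (if (m : ℕ) = 1 then α else if (m : ℕ) = 2 then 1 else 0)
    else if (i : ℕ) = 1 ∧ (j : ℕ) = 0 then
      (if (m : ℕ) = 1 then 1 - α else if (m : ℕ) = 2 then -1 else 0)
    else if (i : ℕ) = 0 ∧ 2 ≤ (j : ℕ) then (if m = j then β else 0)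
    else if 2 ≤ (i : ℕ) ∧ (j : ℕ) = 0 then (if m = i then 1 - β else 0)
    else 0

/-- `T₀³`: `e₁e₂ = e₃`, `e₂e₁ = -e₃`, `e₁e₃ = e₄`, `e₃e₁ = -e₄`. -/
def T03str (n : ℕ) : AlgStr k n :=
  ofConst fun i j m =>
    if (i : ℕ) = 0 ∧ (j : ℕ) = 1 ∧ (m : ℕ) = 2 then 1
    else if (i : ℕ) = 1 ∧ (j : ℕ) = 0 ∧ (m : ℕ) = 2 then -1
    else if (i : ℕ) = 0 ∧ (j : ℕ) = 2 ∧ (m : ℕ) = 3 then 1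
    else if (i : ℕ) = 2 ∧ (j : ℕ) = 0 ∧ (m : ℕ) = 3 then -1
    else 0

/-- `T₀^{2,2}`: `e₁e₂ = e₃`, `e₂e₁ = -e₃`, `e₁e₄ = e₅`, `e₄e₁ = -e₅`. -/
def T022str (n : ℕ) : AlgStr k n :=
  ofConst fun i j m =>
    if (i : ℕ) = 0 ∧ (j : ℕ) = 1 ∧ (m : ℕ) = 2 then 1
    else if (i : ℕ) = 1 ∧ (j : ℕ) = 0 ∧ (m : ℕ) = 2 then -1
    else if (i : ℕ) = 0 ∧ (j : ℕ) = 3 ∧ (m : ℕ) = 4 then 1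
    else if (i : ℕ) = 3 ∧ (j : ℕ) = 0 ∧ (m : ℕ) = 4 then -1
    else 0

/-- `η_l ⊕ k^{n-2l-1}`: `e_{2i-1}e_{2i} = e_{2l+1}`, `e_{2i}e_{2i-1} = -e_{2l+1}`
for `1 ≤ i ≤ l`. -/
def etaStr (n l : ℕ) : AlgStr k n :=
  ofConst fun i j m =>
    if (i : ℕ) % 2 = 0 ∧ (j : ℕ) = (i : ℕ) + 1 ∧ (i : ℕ) < 2 * l ∧ (m : ℕ) = 2 * l then 1
    else if (j : ℕ) % 2 = 0 ∧ (i : ℕ) = (j : ℕ) + 1 ∧ (j : ℕ) < 2 * l ∧ (m : ℕ) = 2 * l then -1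
    else 0

/-- `F^{α,β} ⊕ k^{n-3}`: `e₁e₁ = e₃`, `e₁e₂ = αe₃`, `e₂e₁ = βe₃`. -/
def FabStr (n : ℕ) (α β : k) : AlgStr k n :=
  ofConst fun i j m =>
    if (i : ℕ) = 0 ∧ (j : ℕ) = 0 ∧ (m : ℕ) = 2 then 1
    else if (i : ℕ) = 0 ∧ (j : ℕ) = 1 ∧ (m : ℕ) = 2 then α
    else if (i : ℕ) = 1 ∧ (j : ℕ) = 0 ∧ (m : ℕ) = 2 then β
    else 0

/-- `k^{n-2} ⋊ A₃`: `e₁e₁ = e₂`, `e₁eᵢ = eᵢ`, `eᵢe₁ = -eᵢ` for `i ≥ 3`. -/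
def kA3str (n : ℕ) : AlgStr k n :=
  ofConst fun i j m =>
    if (i : ℕ) = 0 ∧ (j : ℕ) = 0 ∧ (m : ℕ) = 1 then 1
    else if (i : ℕ) = 0 ∧ 2 ≤ (j : ℕ) then (if m = j then 1 else 0)
    else if 2 ≤ (i : ℕ) ∧ (j : ℕ) = 0 then (if m = i then -1 else 0)
    else 0

/-- `k² ⋊_{α,β} A₃ ⊕ k^{n-4}`: `e₁e₁ = e₂`, `e₁e₃ = αe₄`, `e₃e₁ = βe₄`. -/
def k2A3str (n : ℕ) (α β : k) : AlgStr k n :=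
  ofConst fun i j m =>
    if (i : ℕ) = 0 ∧ (j : ℕ) = 0 ∧ (m : ℕ) = 1 then 1
    else if (i : ℕ) = 0 ∧ (j : ℕ) = 2 ∧ (m : ℕ) = 3 then α
    else if (i : ℕ) = 2 ∧ (j : ℕ) = 0 ∧ (m : ℕ) = 3 then β
    else 0

/-- `k^{n-2} ⋊_α A₁^α`: `e₁e₁ = e₁ + e₂`, `e₁eᵢ = αeᵢ`, `eᵢe₁ = (1-α)eᵢ` for `i ≥ 2`. -/
def kA1str (n : ℕ) (α : k) : AlgStr k n :=
  ofConst fun i j m =>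
    if (i : ℕ) = 0 ∧ (j : ℕ) = 0 then (if (m : ℕ) = 0 ∨ (m : ℕ) = 1 then 1 else 0)
    else if (i : ℕ) = 0 then (if m = j then α else 0)
    else if (j : ℕ) = 0 then (if m = i then 1 - α else 0)
    else 0

/-- `k^{n-2} ⋊₁ A₂`: `e₁e₁ = e₂`, `e₁eᵢ = eᵢ`, `eᵢe₁ = -eᵢ` for `i ≥ 2`. -/
def kA2str (n : ℕ) : AlgStr k n :=
  ofConst fun i j m =>
    if (i : ℕ) = 0 ∧ (j : ℕ) = 0 then (if (m : ℕ) = 1 then 1 else 0)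
    else if (i : ℕ) = 0 then (if m = j then 1 else 0)
    else if (j : ℕ) = 0 then (if m = i then -1 else 0)
    else 0

/-- `k^{n-2} ⋊₀ᵗ B₂^α`: `e₁eᵢ = αeᵢ`, `eᵢe₁ = (1-α)eᵢ` for `i ≥ 2`. -/
def ktB2str (n : ℕ) (α : k) : AlgStr k n :=
  ofConst fun i j m =>
    if (i : ℕ) = 0 ∧ 1 ≤ (j : ℕ) then (if m = j then α else 0)
    else if 1 ≤ (i : ℕ) ∧ (j : ℕ) = 0 then (if m = i then 1 - α else 0)
    else 0

/-- `k^{n-2} ⋊₀ᵗ D₂^{α,β}`: `e₁e₁ = e₁`, `e₁eᵢ = αeᵢ`, `eᵢe₁ = βeᵢ` for `i ≥ 2`. -/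
def ktD2str (n : ℕ) (α β : k) : AlgStr k n :=
  ofConst fun i j m =>
    if (i : ℕ) = 0 ∧ (j : ℕ) = 0 then (if (m : ℕ) = 0 then 1 else 0)
    else if (i : ℕ) = 0 then (if m = j then α else 0)
    else if (j : ℕ) = 0 then (if m = i then β else 0)
    else 0


theorem Tstr_apply {m : ℕ} (α : k) (M : Matrix (Fin m) (Fin m) k) (x y : Fin (m + 1) → k) :
    Tstr α M x y = Fin.cons (α * (x 0 * y 0))
      (x 0 • M.mulVec (Fin.tail y) + y 0 • (α • Fin.tail x - M.mulVec (Fin.tail x))) := by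
  funext t
  refine Fin.cases ?_ (fun i => ?_) t
  · simp [Tstr, ofConst, Fin.sum_univ_succ, mul_comm]
  · have h₁ : ∑ j : Fin m, x 0 * y j.succ * M i j = x 0 * ∑ j, M i j * y j.succ := by
      rw [Finset.mul_sum]
      exact Finset.sum_congr rfl fun j _ => by ring
    have h₂ : ∑ j : Fin m, x j.succ * y 0 * ((if j = i then α else 0) - M i j) =
        y 0 * (α * x i.succ - ∑ j, M i j * x j.succ) := by
      have (j : Fin m) : x j.succ * y 0 * ((if j = i then α else 0) - M i j) =
          (if j = i then y 0 * (α * x j.succ) else 0) - y 0 * (M i j * x j.succ) := by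
        split_ifs <;> ring
      simp [this, Finset.mul_sum, mul_sub]
    simp [Tstr, ofConst, Fin.sum_univ_succ, Matrix.mulVec, dotProduct, Fin.tail, h₁, h₂]

theorem Tstr_apply_self {m : ℕ} (α : k) (M : Matrix (Fin m) (Fin m) k) (x : Fin (m + 1) → k) :
    Tstr α M x x = (α * x 0) • x := by
  rw [Tstr_apply]
  funext t
  refine Fin.cases ?_ (fun i => ?_) t
  · simp [mul_assoc]
  · simp [Fin.tail]; ring

theorem mem_orbit_iff {n : ℕ} {μ χ : AlgStr k n} :
    χ ∈ orbit μ ↔ ∃ g : (Fin n → k) ≃ₗ[k] (Fin n → k), ∀ x y, g (μ x y) = χ (g x) (g y) := by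
  refine exists_congr fun g => ⟨fun h x y => ?_, fun h => ?_⟩
  · simp [← h, transport]
  · refine LinearMap.ext fun x => LinearMap.ext fun y => ?_
    simp [transport, h]

theorem genType_one_iff {n : ℕ} (hn : 0 < n) (μ : AlgStr k n) :
    genType μ 1 ↔ ∀ a, ∃ c : k, μ a a = c • a := by
  constructor
  · intro h a
    by_cases ha : a = 0
    · exact ⟨0, by simp [ha]⟩
    have haS : a ∈ subalgGen μ {a} :=
      (Submodule.mem_sInf).2 fun W hW => hW.1 rfl
    have hmS : μ a a ∈ subalgGen μ {a} :=
      (Submodule.mem_sInf).2 fun W hW => hW.2 a (hW.1 rfl) a (hW.1 rfl)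
    have hle : Module.finrank k (subalgGen μ {a}) ≤ 1 := h.2 ⟨a, rfl⟩
    have heq : Submodule.span k {a} = subalgGen μ {a} :=
      Submodule.eq_of_le_of_finrank_le
        ((Submodule.span_singleton_le_iff_mem _ _).2 haS)
        (by rwa [finrank_span_singleton ha])
    rw [← heq] at hmS
    obtain ⟨c, hc⟩ := Submodule.mem_span_singleton.1 hmS
    exact ⟨c, hc.symm⟩
  · intro h
    have hS : ∀ a, subalgGen μ {a} = Submodule.span k {a} := by
      intro a
      refine le_antisymm (sInf_le ⟨Submodule.subset_span, fun x hx y hy => ?_⟩)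
        (le_sInf fun W hW => Submodule.span_le.2 hW.1)
      obtain ⟨s, rfl⟩ := Submodule.mem_span_singleton.1 hx
      obtain ⟨t, rfl⟩ := Submodule.mem_span_singleton.1 hy
      obtain ⟨c, hc⟩ := h a
      exact Submodule.mem_span_singleton.2 ⟨t * (s * c), by simp [hc, mul_smul]⟩
    refine ⟨⟨Pi.single ⟨0, hn⟩ 1, ?_⟩, ?_⟩
    · rw [hS, finrank_span_singleton]
      simp
    · rintro d ⟨a, rfl⟩
      rw [hS]
      exact finrank_span_le_card (R := k) {a} |>.trans (by simp)

theorem genType_one_of_mem_orbit_Tstr {m : ℕ} {α : k} {M : Matrix (Fin m) (Fin m) k}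
    {χ : AlgStr k (m + 1)} (h : χ ∈ orbit (Tstr α M)) : genType χ 1 := by
  obtain ⟨g, hg⟩ := mem_orbit_iff.1 h
  refine (genType_one_iff m.succ_pos χ).2 fun a => ⟨α * g.symm a 0, ?_⟩
  have := hg (g.symm a) (g.symm a)
  rw [Tstr_apply_self] at this
  simpa using this.symm

theorem hasSqZeroIdealCodim1_of_mem_orbit_Tstr {m : ℕ} {α : k} {M : Matrix (Fin m) (Fin m) k}
    {χ : AlgStr k (m + 1)} (h : χ ∈ orbit (Tstr α M)) : hasSqZeroIdealCodim1 χ := by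
  obtain ⟨g, hg⟩ := mem_orbit_iff.1 h
  have hχ : ∀ x y, χ x y = g (Tstr α M (g.symm x) (g.symm y)) := by simp [hg]
  let φ : Module.Dual k (Fin (m + 1) → k) := LinearMap.proj 0 ∘ₗ g.symm.toLinearMap
  have hφ : φ ≠ 0 := fun h0 => by
    have := LinearMap.congr_fun h0 (g (Pi.single 0 1))
    simp [φ] at this
  refine ⟨LinearMap.ker φ, ?_, fun x hx y => ?_, fun x hx y hy => ?_⟩
  · have := Module.Dual.finrank_ker_add_one_of_ne_zero hφ
    simp only [Module.finrank_fin_fun] at this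
    omega
  · have hx' : g.symm x 0 = 0 := hx
    constructor <;> simp [φ, hχ, Tstr_apply, hx']
  · have hx' : g.symm x 0 = 0 := hx
    have hy' : g.symm y 0 = 0 := hy
    have : (Fin.cons 0 0 : Fin (m + 1) → k) = 0 := by
      funext t; refine Fin.cases ?_ (fun i => ?_) t <;> simp
    simp [hχ, Tstr_apply, hx', hy', this]

theorem exists_mem_orbit_Tstr {m : ℕ} {μ : AlgStr k (m + 1)} (hgen : genType μ 1)
    (hI : hasSqZeroIdealCodim1 μ) :
    ∃ r : k, (r = 0 ∨ r = 1) ∧ ∃ M : Matrix (Fin m) (Fin m) k, μ ∈ orbit (Tstr r M) := by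
  rw [genType_one_iff m.succ_pos] at hgen
  obtain ⟨I, hdim, hideal, hzero⟩ := hI
  have hItop : ∃ e, e ∉ I := by
    by_contra! h
    have : I = ⊤ := eq_top_iff.2 fun x _ => h x
    rw [this, finrank_top, Module.finrank_fin_fun] at hdim
    omega
  obtain ⟨r, hr, e, he, hee⟩ :
      ∃ r : k, (r = 0 ∨ r = 1) ∧ ∃ e, e ∉ I ∧ μ e e = r • e := by
    obtain ⟨e, he⟩ := hItop
    obtain ⟨c, hc⟩ := hgen e
    by_cases h0 : c = 0
    · exact ⟨0, Or.inl rfl, e, he, by rw [hc, h0]⟩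
    · refine ⟨1, Or.inr rfl, c⁻¹ • e, fun h => he ?_, ?_⟩
      · simpa [smul_smul, h0] using I.smul_mem c h
      · simp [hc, smul_smul, h0]
  have hanti : ∀ x ∈ I, μ x e = r • x - μ e x := by
    intro x hx
    obtain ⟨c, hc⟩ := hgen (e + x)
    have hexp : μ (e + x) (e + x) = r • e + (μ e x + μ x e) := by
      simp only [map_add, LinearMap.add_apply, hee, hzero x hx x hx]
      abel
    have hmem : (c - r) • e ∈ I := by
      have : (c - r) • e = (μ e x + μ x e) - c • x := by
        rw [hexp, smul_add] at hc
        rw [sub_smul, sub_eq_sub_iff_add_eq_add, add_comm _ (r • e), hc]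
      rw [this]
      exact I.sub_mem (I.add_mem (hideal x hx e).2 (hideal x hx e).1) (I.smul_mem _ hx)
    have hcr : c = r := by
      by_contra hne
      refine he ?_
      simpa [smul_smul, sub_ne_zero.2 hne] using I.smul_mem (c - r)⁻¹ hmem
    rw [hexp, hcr, smul_add, add_right_inj] at hc
    exact eq_sub_of_add_eq' hc
  have hfin : Module.finrank k (Fin m → k) = Module.finrank k I := by simp [hdim]
  let f : (Fin m → k) ≃ₗ[k] I := LinearEquiv.ofFinrankEq _ _ hfin
  let g₀ : (Fin (m + 1) → k) →ₗ[k] (Fin (m + 1) → k) :=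
    (LinearMap.proj 0).smulRight e +
      I.subtype ∘ₗ f.toLinearMap ∘ₗ LinearMap.funLeft k k Fin.succ
  have hg₀ : ∀ x, g₀ x = x 0 • e + (f (Fin.tail x) : Fin (m + 1) → k) := fun x => rfl
  have hinj : Function.Injective g₀ := by
    refine (injective_iff_map_eq_zero g₀).2 fun x hx => ?_
    rw [hg₀] at hx
    have h0 : x 0 = 0 := by
      by_contra hne
      have hmem : x 0 • e ∈ I := by
        rw [eq_neg_of_add_eq_zero_left hx]
        exact I.neg_mem (f (Fin.tail x)).2
      exact he (by simpa [smul_smul, hne] using I.smul_mem (x 0)⁻¹ hmem)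
    have h1 : Fin.tail x = 0 := by simpa [h0] using hx
    funext t
    refine Fin.cases h0 (fun i => congrFun h1 i) t
  let φ : (Fin m → k) →ₗ[k] (Fin m → k) :=
    f.symm.toLinearMap ∘ₗ
      LinearMap.codRestrict I (μ e ∘ₗ I.subtype ∘ₗ f.toLinearMap)
        (fun y => (hideal _ (f y).2 e).2)
  have hφ : ∀ y, (f (φ y) : Fin (m + 1) → k) = μ e (f y) := fun y => by
    simp only [φ, LinearMap.comp_apply, LinearEquiv.coe_coe, LinearEquiv.apply_symm_apply]
    rfl
  refine ⟨r, hr, LinearMap.toMatrix' φ, mem_orbit_iff.2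
    ⟨LinearEquiv.ofInjectiveEndo g₀ hinj, fun x y => ?_⟩⟩
  simp only [LinearEquiv.coe_ofInjectiveEndo, hg₀, Tstr_apply, LinearMap.toMatrix'_mulVec]
  simp only [Fin.cons_zero, Fin.tail_cons, map_add, map_smul, map_sub, LinearMap.add_apply,
    LinearMap.smul_apply, Submodule.coe_add, Submodule.coe_smul, Submodule.coe_sub, hφ, hee,
    hanti _ (f _).2, hzero _ (f _).2 _ (f _).2]
  module

/-- The embedding of `kᵐ` in `kᵐ⁺¹` as the hyperplane of vectors with zeroth coordinate `0`. -/
def consZero (k : Type*) [Field k] (m : ℕ) : (Fin m → k) →ₗ[k] (Fin (m + 1) → k) where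
  toFun y := Fin.cons 0 y
  map_add' x y := by funext t; refine Fin.cases ?_ (fun i => ?_) t <;> simp
  map_smul' a x := by funext t; refine Fin.cases ?_ (fun i => ?_) t <;> simp

theorem consZero_apply {m : ℕ} (y : Fin m → k) : consZero k m y = Fin.cons 0 y := rfl

theorem exists_similar_of_hyperplane {m : ℕ} {r s : k} {M L : Matrix (Fin m) (Fin m) k}
    (g : (Fin (m + 1) → k) ≃ₗ[k] (Fin (m + 1) → k))
    (hg : ∀ x y, g (Tstr r M x y) = Tstr s L (g x) (g y))
    (hI : ∀ x : Fin (m + 1) → k, x 0 = 0 → g x 0 = 0) :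
    g (Pi.single 0 1) 0 ≠ 0 ∧ ∃ U : (Matrix (Fin m) (Fin m) k)ˣ,
      L = (g (Pi.single 0 1) 0)⁻¹ • (U.inv * M * U.val) := by
  set c := g (Pi.single 0 1) 0 with hc
  have hg0 : ∀ x, g x 0 = x 0 * c := by
    intro x
    have h := hI (x - x 0 • Pi.single 0 1) (by simp)
    simpa [sub_eq_zero, ← hc] using h
  have hc0 : c ≠ 0 := by
    intro h
    have := hg0 (g.symm (Pi.single 0 1))
    simp [h] at this
  let G : (Fin m → k) →ₗ[k] (Fin m → k) :=
    LinearMap.funLeft k k Fin.succ ∘ₗ g.toLinearMap ∘ₗ consZero k m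
  have hG : ∀ y, G y = Fin.tail (g (Fin.cons 0 y)) := fun y => rfl
  have hGinj : Function.Injective G := by
    refine (injective_iff_map_eq_zero G).2 fun y hy => ?_
    have h : g (Fin.cons 0 y) = 0 := by
      funext t
      exact Fin.cases (hI _ (Fin.cons_zero _ _)) (fun i => congrFun hy i) t
    have h' : (Fin.cons 0 y : Fin (m + 1) → k) = 0 := by simpa using h
    funext i
    simpa using congrFun h' i.succ
  have hcomm : ∀ y, G (M.mulVec y) = c • L.mulVec (G y) := by
    intro y
    have h := congrArg Fin.tail (hg (Pi.single 0 1) (Fin.cons 0 y))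
    have h0 : g (Fin.cons 0 y) 0 = 0 := hI _ (Fin.cons_zero _ _)
    simpa [Tstr_apply, h0, ← hc, ← hG] using h
  have hP : IsUnit (LinearMap.toMatrix' G) := by
    rw [← Matrix.mulVec_injective_iff_isUnit]
    intro x y hxy
    exact hGinj (by simpa only [LinearMap.toMatrix'_mulVec] using hxy)
  obtain ⟨P, hPG⟩ := hP
  have hPM : P.val * M = c • (L * P.val) := by
    refine Matrix.ext_of_mulVec_single fun i => ?_
    simp only [Matrix.smul_mulVec, ← Matrix.mulVec_mulVec, hPG, LinearMap.toMatrix'_mulVec]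
    exact hcomm _
  refine ⟨hc0, P⁻¹, ?_⟩
  have : (P⁻¹).inv = P.val := rfl
  rw [this, hPM, Matrix.smul_mul, Matrix.mul_assoc, Units.mul_inv, Matrix.mul_one, smul_smul,
    inv_mul_cancel₀ hc0, one_smul]

theorem Tstr_mem_orbit_of_similar {m : ℕ} {r α : k} {M L : Matrix (Fin m) (Fin m) k}
    (hα : α ≠ 0) (hr : r * α = r) (U : (Matrix (Fin m) (Fin m) k)ˣ)
    (hL : L = α • (U.inv * M * U.val)) : Tstr r L ∈ orbit (Tstr r M) := by
  have hrα : r * α⁻¹ = r := by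
    rw [← div_eq_mul_inv, div_eq_iff hα, hr]
  have hLU : L * U.inv = α • (U.inv * M) := by
    rw [hL, Matrix.smul_mul, Matrix.mul_assoc, U.val_inv, Matrix.mul_one]
  let g₀ : (Fin (m + 1) → k) →ₗ[k] (Fin (m + 1) → k) :=
    (LinearMap.proj 0).smulRight (Pi.single 0 α⁻¹) +
      consZero k m ∘ₗ Matrix.mulVecLin U.inv ∘ₗ LinearMap.funLeft k k Fin.succ
  have hg₀ : ∀ x, g₀ x = Fin.cons (α⁻¹ * x 0) (U.inv.mulVec (Fin.tail x)) := by
    intro x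
    have : g₀ x = x 0 • Pi.single 0 α⁻¹ + Fin.cons 0 (U.inv.mulVec (Fin.tail x)) := rfl
    rw [this]
    funext t
    refine Fin.cases ?_ (fun i => ?_) t <;> simp [mul_comm]
  have hinj : Function.Injective g₀ := by
    refine (injective_iff_map_eq_zero g₀).2 fun x hx => ?_
    rw [hg₀] at hx
    have h0 : x 0 = 0 := by simpa [hα] using congrFun hx 0
    have h1 : U.inv.mulVec (Fin.tail x) = 0 := by
      funext i; simpa using congrFun hx i.succ
    have h2 : Fin.tail x = 0 := by
      simpa [Matrix.mulVec_mulVec, -Units.inv_eq_val_inv, U.val_inv] using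
        congrArg U.val.mulVec h1
    funext t
    exact Fin.cases h0 (fun i => congrFun h2 i) t
  refine mem_orbit_iff.2 ⟨LinearEquiv.ofInjectiveEndo g₀ hinj, fun x y => ?_⟩
  simp only [LinearEquiv.coe_ofInjectiveEndo, hg₀, Tstr_apply, Fin.cons_zero, Fin.tail_cons,
    Matrix.mulVec_mulVec, hLU, Matrix.mulVec_add, Matrix.mulVec_sub, Matrix.mulVec_smul,
    Matrix.smul_mulVec]
  congr 1
  · linear_combination (-(α⁻¹ * x 0 * y 0)) * hrα
  · have h1 : (α⁻¹ * x 0) * α = x 0 := by field_simp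
    have h2 : (α⁻¹ * y 0) * α = y 0 := by field_simp
    have h3 : (α⁻¹ * y 0) * r = y 0 * r := by linear_combination y 0 * hrα
    simp only [smul_sub, smul_smul, h1, h2, h3]

/-- If the coordinate functionals `a`, `b` have a dual pair `p`, `q`, and `c` is killed by both,
the algebra with product `(a ∧ b) • c` has an automorphism exchanging the kernels. -/
theorem exists_automorphism_swap_ker {V : Type*} [AddCommGroup V] [Module k V]
    [FiniteDimensional k V] (μ : V →ₗ[k] V →ₗ[k] V) (a b : V →ₗ[k] k) (p q c : V)
    (hap : a p = 1) (hbp : b p = 0) (haq : a q = 0) (hbq : b q = 1) (hac : a c = 0)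
    (hbc : b c = 0) (hμ : ∀ u v, μ u v = (a u * b v - a v * b u) • c) :
    ∃ σ : V ≃ₗ[k] V, (∀ u v, σ (μ u v) = μ (σ u) (σ v)) ∧ ∀ v, a (σ v) = -b v := by
  let σ₀ : V →ₗ[k] V := LinearMap.id + a.smulRight (q - p) - b.smulRight (p + q)
  have hσ : ∀ v, σ₀ v = v + a v • (q - p) - b v • (p + q) := fun v => rfl
  have ha : ∀ v, a (σ₀ v) = -b v := fun v => by simp [hσ, hap, haq]
  have hb : ∀ v, b (σ₀ v) = a v := fun v => by simp [hσ, hbp, hbq]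
  have hinj : Function.Injective σ₀ := by
    refine (injective_iff_map_eq_zero σ₀).2 fun v hv => ?_
    have h1 : b v = 0 := by simpa [hv] using ha v
    have h2 : a v = 0 := by simpa [hv] using (hb v).symm
    simpa [hσ, h1, h2] using hv
  have hσc : σ₀ c = c := by simp [hσ, hac, hbc]
  refine ⟨LinearEquiv.ofInjectiveEndo σ₀ hinj, fun u v => ?_, ha⟩
  simp only [LinearEquiv.coe_ofInjectiveEndo, hμ, map_smul, hσc, ha, hb]
  congr 1
  ring

theorem exists_hyperplane_preserving {m : ℕ} {M L : Matrix (Fin m) (Fin m) k} (hL : L ≠ 0)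
    (g : (Fin (m + 1) → k) ≃ₗ[k] (Fin (m + 1) → k))
    (hg : ∀ x y, g (Tstr 0 M x y) = Tstr 0 L (g x) (g y)) :
    ∃ g' : (Fin (m + 1) → k) ≃ₗ[k] (Fin (m + 1) → k),
      (∀ x y, g' (Tstr 0 M x y) = Tstr 0 L (g' x) (g' y)) ∧
      ∀ x : Fin (m + 1) → k, x 0 = 0 → g' x 0 = 0 := by
  by_cases hI : ∀ x : Fin (m + 1) → k, x 0 = 0 → g x 0 = 0
  · exact ⟨g, hg, hI⟩
  push Not at hI
  obtain ⟨x₀, hx₀, hgx₀⟩ := hI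
  let A : (Fin (m + 1) → k) →ₗ[k] k := LinearMap.proj 0 ∘ₗ g.symm.toLinearMap
  have hA : ∀ u, A u = g.symm u 0 := fun u => rfl
  have hT : ∀ u v, Tstr 0 L u v = g (Tstr 0 M (g.symm u) (g.symm v)) := by simp [hg]
  have hAT : ∀ u v, A (Tstr 0 L u v) = 0 := by simp [hA, hT, Tstr_apply]
  have hTA : ∀ u v, A u = 0 → A v = 0 → Tstr 0 L u v = 0 := by
    intro u v hu hv
    rw [hA] at hu hv
    have : (Fin.cons 0 0 : Fin (m + 1) → k) = 0 := by
      funext t; refine Fin.cases ?_ (fun i => ?_) t <;> simp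
    simp [hT, Tstr_apply, hu, hv, this]
  set z := g x₀
  have hAz : A z = 0 := by simp [hA, z, hx₀]
  have hker : ∀ y, A (Fin.cons 0 y) = 0 → L.mulVec y = 0 := by
    intro y hy
    have h := congrArg Fin.tail (hTA z _ hAz hy)
    rw [Tstr_apply] at h
    have h' : z 0 • L.mulVec y = 0 := by
      simpa only [Fin.tail_cons, Fin.cons_zero, zero_smul, add_zero] using h.trans (rfl : _ = (0 : Fin m → k))
    exact (smul_eq_zero.1 h').resolve_left hgx₀
  obtain ⟨y, hy⟩ : ∃ y, L.mulVec y ≠ 0 := by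
    by_contra! h
    exact hL (Matrix.ext_of_mulVec_single fun i => by rw [h, Matrix.zero_mulVec])
  have hAy : A (Fin.cons 0 y) ≠ 0 := fun h => hy (hker y h)
  set q : Fin (m + 1) → k := (A (Fin.cons 0 y))⁻¹ • Fin.cons 0 y with hq
  have hAq : A q = 1 := by simp [hq, hAy]
  have hq0 : q 0 = 0 := by simp [hq]
  have hLA : ∀ v, L.mulVec v = A (Fin.cons 0 v) • L.mulVec (Fin.tail q) := by
    intro v
    have hcons : (Fin.cons 0 (v - A (Fin.cons 0 v) • Fin.tail q) : Fin (m + 1) → k) =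
        Fin.cons 0 v - A (Fin.cons 0 v) • q := by
      funext t
      refine Fin.cases ?_ (fun i => ?_) t <;> simp [hq0, Fin.tail]
    have := hker (v - A (Fin.cons 0 v) • Fin.tail q) (by rw [hcons]; simp [hAq])
    rwa [Matrix.mulVec_sub, Matrix.mulVec_smul, sub_eq_zero] at this
  have htail : ∀ v : Fin (m + 1) → k,
      A (Fin.cons 0 (Fin.tail v)) = A v - v 0 * A (Pi.single 0 1) := by
    intro v
    have : (Fin.cons 0 (Fin.tail v) : Fin (m + 1) → k) = v - v 0 • Pi.single 0 1 := by
      funext t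
      refine Fin.cases ?_ (fun i => ?_) t <;> simp [Fin.tail]
    rw [this]
    simp
  have hform : ∀ u v, Tstr 0 L u v =
      (u 0 * A v - v 0 * A u) • (Fin.cons 0 (L.mulVec (Fin.tail q)) : Fin (m + 1) → k) := by
    intro u v
    rw [Tstr_apply, hLA (Fin.tail u), hLA (Fin.tail v), htail, htail]
    funext t
    refine Fin.cases ?_ (fun i => ?_) t
    · simp
    · simp
      ring
  have hAc : A (Fin.cons 0 (L.mulVec (Fin.tail q))) = 0 := by
    have h := hAT z q
    rw [hform, hAq, hq0] at h
    simpa [hgx₀] using h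
  obtain ⟨σ, hσ, hσa⟩ := exists_automorphism_swap_ker (Tstr 0 L) (LinearMap.proj 0) A
    ((z 0)⁻¹ • z) q _ (by simp [hgx₀]) (by simp [hAz]) hq0 hAq (by simp) hAc hform
  refine ⟨g.trans σ, fun x y => by simp [hg, hσ], fun x hx => ?_⟩
  have := hσa (g x)
  simpa [hA, hx] using this

theorem eq_zero_of_Tstr_zero_mem_orbit {m : ℕ} {M : Matrix (Fin m) (Fin m) k}
    (h : Tstr 0 (0 : Matrix (Fin m) (Fin m) k) ∈ orbit (Tstr 0 M)) : M = 0 := by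
  obtain ⟨g, hg⟩ := mem_orbit_iff.1 h
  have hz : ∀ x y, Tstr 0 (0 : Matrix (Fin m) (Fin m) k) x y = 0 := by
    intro x y
    rw [Tstr_apply]
    funext t
    refine Fin.cases ?_ (fun i => ?_) t <;> simp
  refine Matrix.ext_of_mulVec_single fun i => ?_
  have h1 : Tstr 0 M (Pi.single 0 1) (Fin.cons 0 (Pi.single i 1)) = 0 := by
    simpa [hz] using hg (Pi.single 0 1) (Fin.cons 0 (Pi.single i 1))
  have h2 := congrArg Fin.tail h1
  rw [Tstr_apply] at h2
  rw [Matrix.zero_mulVec]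
  simpa only [Fin.tail_cons, Fin.cons_zero, zero_smul, add_zero, Pi.single_eq_same,
    one_smul] using h2.trans (rfl : _ = (0 : Fin m → k))

theorem mul_coord_eq_of_Tstr_iso {m : ℕ} {r s : k} {M L : Matrix (Fin m) (Fin m) k}
    (g : (Fin (m + 1) → k) ≃ₗ[k] (Fin (m + 1) → k))
    (hg : ∀ x y, g (Tstr r M x y) = Tstr s L (g x) (g y)) (x : Fin (m + 1) → k) :
    r * x 0 = s * g x 0 := by
  have key : ∀ x, x ≠ 0 → r * x 0 = s * g x 0 := by
    intro x hx
    have h := hg x x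
    rw [Tstr_apply_self, Tstr_apply_self, map_smul] at h
    exact smul_left_injective k (by simpa using hx) h
  by_cases hx : x = 0
  · simp [hx]
  · exact key x hx

/-! ## STATEMENT 5 -/
theorem stmt5 {k : Type*} [Field k] [IsAlgClosed k] (m : ℕ) (hm : 1 ≤ m) :
    ({μ : AlgStr k (m + 1) | genType μ 1 ∧ hasSqZeroIdealCodim1 μ} =
      (⋃ M : Matrix (Fin m) (Fin m) k, orbit (Tstr 0 M)) ∪
        ⋃ M : Matrix (Fin m) (Fin m) k, orbit (Tstr 1 M)) ∧
    ∀ r s : k, (r = 0 ∨ r = 1) → (s = 0 ∨ s = 1) →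
      ∀ M L : Matrix (Fin m) (Fin m) k,
        (Tstr s L ∈ orbit (Tstr r M) ↔
          ((r = 1 ∧ s = 1 ∧ ∃ U : (Matrix (Fin m) (Fin m) k)ˣ,
              L = U.inv * M * U.val) ∨
           (r = 0 ∧ s = 0 ∧ ∃ α : k, α ≠ 0 ∧ ∃ U : (Matrix (Fin m) (Fin m) k)ˣ,
              L = α • (U.inv * M * U.val)))) := by
  refine ⟨Set.ext fun μ => ⟨fun ⟨hgen, hI⟩ => ?_, fun h => ?_⟩, fun r s hr hs M L =>
    ⟨fun h => ?_, ?_⟩⟩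
  · obtain ⟨r, rfl | rfl, M, hM⟩ := exists_mem_orbit_Tstr hgen hI
    · exact Or.inl (Set.mem_iUnion.2 ⟨M, hM⟩)
    · exact Or.inr (Set.mem_iUnion.2 ⟨M, hM⟩)
  · rcases h with h | h <;> obtain ⟨M, hM⟩ := Set.mem_iUnion.1 h <;>
      exact ⟨genType_one_of_mem_orbit_Tstr hM, hasSqZeroIdealCodim1_of_mem_orbit_Tstr hM⟩
  · obtain ⟨g, hg⟩ := mem_orbit_iff.1 h
    have hcoord := mul_coord_eq_of_Tstr_iso g hg
    rcases hr with rfl | rfl <;> rcases hs with rfl | rfl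
    · refine Or.inr ⟨rfl, rfl, ?_⟩
      by_cases hL : L = 0
      · subst hL
        exact ⟨1, one_ne_zero, 1, by simp [eq_zero_of_Tstr_zero_mem_orbit h]⟩
      · obtain ⟨g', hg', hI⟩ := exists_hyperplane_preserving hL g hg
        obtain ⟨hc, U, hU⟩ := exists_similar_of_hyperplane g' hg' hI
        exact ⟨_, inv_ne_zero hc, U, hU⟩
    · simpa using hcoord (g.symm (Pi.single 0 1))
    · simpa using hcoord (Pi.single 0 1)
    · simp only [one_mul] at hcoord
      obtain ⟨-, U, hU⟩ := exists_similar_of_hyperplane g hg fun x hx => by rw [← hcoord, hx]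
      refine Or.inl ⟨rfl, rfl, U, ?_⟩
      rw [hU, ← hcoord]
      simp
  · rintro (⟨rfl, rfl, U, hU⟩ | ⟨rfl, rfl, α, hα, U, hU⟩)
    · exact Tstr_mem_orbit_of_similar one_ne_zero (mul_one 1) U (by rw [one_smul, hU])
    · exact Tstr_mem_orbit_of_similar hα (zero_mul α) U hU

end
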